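/- Let G be a group and A an abelian normal subgroup of G such that G/A is a finitely generated nilpotent group. Suppose A is G-monolithic with G-monolith M, and M is not G-central. Then [A, G] = A. -/

import Mathlib

open Pointwise commutatorElement

section
variable {D M Γ : Type*} [CommRing D] [AddCommGroup M] [Module D M] [Group Γ]
  [DistribMulAction Γ M]

variable (D) in
/-- The `D`-submodule generated by the translates of `s` under the subgroup `H`. -/
def orbitSpan (H : Subgroup Γ) (s : Set M) : Submodule D M :=
  Submodule.span D ((H : Set Γ) • s)

theorem subset_orbitSpan (H : Subgroup Γ) (s : Set M) : s ⊆ orbitSpan D H s := fun x hx =>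
  Submodule.subset_span ⟨1, H.one_mem, x, hx, one_smul _ _⟩

theorem orbitSpan_mono {H K : Subgroup Γ} (h : H ≤ K) (s : Set M) :
    orbitSpan D H s ≤ orbitSpan D K s :=
  Submodule.span_mono (Set.smul_subset_smul_right h)

theorem orbitSpan_bot (s : Set M) : orbitSpan D (⊥ : Subgroup Γ) s = Submodule.span D s := by
  simp [orbitSpan]

variable [SMulCommClass Γ D M]

/-- The factor `B / A` has no `d`-torsion for the primes `d` not dividing `f`, and it is either
`f`-power torsion or not divisible by any such prime. -/
def GenericFactor (f : D) (A B : Submodule D M) : Prop :=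
  ∀ d : D, Prime d → ¬ d ∣ f → (∀ x ∈ B, d • x ∈ A → x ∈ A) ∧
    ((∀ x ∈ B, ∃ k : ℕ, f ^ k • x ∈ A) ∨ ∃ y ∈ B, ∀ x ∈ B, d • x - y ∉ A)

theorem GenericFactor.of_dvd {f f' : D} {A B : Submodule D M} (h : GenericFactor f A B)
    (hf : f ∣ f') : GenericFactor f' A B := by
  intro d hd hdf
  obtain ⟨h1, h2⟩ := h d hd fun h' => hdf (h'.trans hf)
  refine ⟨h1, h2.imp_left fun h3 x hx => ?_⟩
  obtain ⟨k, hk⟩ := h3 x hx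
  obtain ⟨c, rfl⟩ := hf
  refine ⟨k, ?_⟩
  rw [mul_comm, mul_pow, mul_smul]
  exact A.smul_mem _ hk

theorem GenericFactor.iSup {f : D} (L : ℕ → Submodule D M) (hL : Monotone L)
    (h : ∀ n, GenericFactor f (L n) (L (n + 1))) : GenericFactor f (L 0) (⨆ n, L n) := by
  intro d hd hdf
  have hmem : ∀ x, x ∈ ⨆ n, L n ↔ ∃ n, x ∈ L n := fun x =>
    Submodule.mem_iSup_of_directed L hL.directed_le
  have key : ∀ n m x, x ∈ L n → d • x ∈ L m → x ∈ L m := by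
    intro n m x
    induction n with
    | zero => exact fun hx _ => hL (Nat.zero_le m) hx
    | succ n ih =>
      intro hx hdx
      rcases le_or_gt (n + 1) m with hnm | hnm
      · exact hL hnm hx
      · exact ih ((h n d hd hdf).1 x hx (hL (Nat.lt_succ_iff.1 hnm) hdx)) hdx
  refine ⟨fun x hx hdx => ?_, ?_⟩
  · obtain ⟨n, hn⟩ := (hmem x).1 hx
    exact key n 0 x hn hdx
  · by_cases hall : ∀ n, ∀ x ∈ L (n + 1), ∃ k : ℕ, f ^ k • x ∈ L n
    · left
      intro x hx
      obtain ⟨n, hn⟩ := (hmem x).1 hx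
      clear hx
      induction n generalizing x with
      | zero => exact ⟨0, by simpa using hn⟩
      | succ n ih =>
        obtain ⟨k, hk⟩ := hall n x hn
        obtain ⟨l, hl⟩ := ih _ hk
        exact ⟨l + k, by rwa [pow_add, mul_smul]⟩
    · right
      push Not at hall
      obtain ⟨n, x0, hx0, hx0'⟩ := hall
      rcases (h n d hd hdf).2 with h' | ⟨y, hy, hy'⟩
      · obtain ⟨k, hk⟩ := h' x0 hx0
        exact absurd hk (hx0' k)
      · refine ⟨y, (hmem y).2 ⟨_, hy⟩, fun x hx hxy => ?_⟩
        obtain ⟨m, hm⟩ := (hmem x).1 hx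
        have : d • x ∈ L (n + 1) := by
          simpa using (L (n + 1)).add_mem (hL (Nat.zero_le _) hxy) hy
        exact hy' x (key m _ x hm this) (hL (Nat.zero_le _) hxy)

theorem GenericFactor.sup {f : D} {A B : Submodule D M} (h : GenericFactor f (A ⊓ B) B) :
    GenericFactor f A (A ⊔ B) := by
  intro d hd hdf
  obtain ⟨h1, h2⟩ := h d hd hdf
  refine ⟨fun x hx hdx => ?_, h2.imp ?_ ?_⟩
  · obtain ⟨a, ha, b, hb, rfl⟩ := Submodule.mem_sup.1 hx
    refine A.add_mem ha (h1 b hb ⟨?_, B.smul_mem _ hb⟩).1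
    rw [smul_add] at hdx
    exact (A.add_mem_iff_right (A.smul_mem _ ha)).1 hdx
  · intro h3 x hx
    obtain ⟨a, ha, b, hb, rfl⟩ := Submodule.mem_sup.1 hx
    obtain ⟨k, hk⟩ := h3 b hb
    exact ⟨k, by rw [smul_add]; exact A.add_mem (A.smul_mem _ ha) hk.1⟩
  · rintro ⟨y, hy, hy'⟩
    refine ⟨y, Submodule.mem_sup_right hy, fun x hx hxy => ?_⟩
    obtain ⟨a, ha, b, hb, rfl⟩ := Submodule.mem_sup.1 hx
    refine hy' b hb ⟨?_, B.sub_mem (B.smul_mem _ hb) hy⟩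
    rw [smul_add, add_sub_assoc] at hxy
    exact (A.add_mem_iff_right (A.smul_mem _ ha)).1 hxy

theorem Submodule.smul_mem_smul_iff_of_group (t : Γ) (A : Submodule D M) (x : M) :
    t • x ∈ t • A ↔ x ∈ A := by
  rw [← SetLike.mem_coe, Submodule.coe_pointwise_smul, Set.smul_mem_smul_set_iff, SetLike.mem_coe]

theorem Submodule.mem_inv_smul_iff_of_group (t : Γ) (A : Submodule D M) (x : M) :
    x ∈ t⁻¹ • A ↔ t • x ∈ A := by
  rw [← Submodule.smul_mem_smul_iff_of_group t, smul_inv_smul]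

theorem GenericFactor.smul {f : D} {A B : Submodule D M} (h : GenericFactor f A B) (t : Γ) :
    GenericFactor f (t • A) (t • B) := by
  intro d hd hdf
  obtain ⟨h1, h2⟩ := h d hd hdf
  have hmem : ∀ x, x ∈ t • B → ∃ y ∈ B, t • y = x := fun x hx =>
    (Submodule.mem_smul_pointwise_iff_exists x t B).1 hx
  refine ⟨fun x hx hdx => ?_, h2.imp ?_ ?_⟩
  · obtain ⟨x, hxB, rfl⟩ := hmem x hx
    rw [← smul_comm t d x, Submodule.smul_mem_smul_iff_of_group] at hdx
    exact Submodule.smul_mem_pointwise_smul _ _ _ (h1 x hxB hdx)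
  · intro h3 x hx
    obtain ⟨x, hxB, rfl⟩ := hmem x hx
    obtain ⟨k, hk⟩ := h3 x hxB
    refine ⟨k, ?_⟩
    rwa [← smul_comm t _ x, Submodule.smul_mem_smul_iff_of_group]
  · rintro ⟨y, hy, hy'⟩
    refine ⟨t • y, Submodule.smul_mem_pointwise_smul _ _ _ hy, fun x hx hxy => ?_⟩
    obtain ⟨x, hxB, rfl⟩ := hmem x hx
    rw [← smul_comm t d x, ← smul_sub, Submodule.smul_mem_smul_iff_of_group] at hxy
    exact hy' x hxB hxy

theorem exists_ne_zero_forall_prime_of_finite [IsDomain D] [IsPrincipalIdealRing D]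
    [Module.Finite D M] :
    ∃ f : D, f ≠ 0 ∧ ∀ d : D, Prime d → ¬ d ∣ f → (∀ x : M, d • x = 0 → x = 0) ∧
      ((∀ x : M, f • x = 0) ∨ ∃ y : M, ∀ x : M, d • x ≠ y) := by
  obtain ⟨f, hf, hf0⟩ := Submodule.annihilator_top_inter_nonZeroDivisors
    (Submodule.torsion_isTorsion (R := D) (M := M))
  have hann : ∀ (x : M) (a : D), a ≠ 0 → a • x = 0 → f • x = 0 := by
    intro x a ha hax
    have hx : x ∈ Submodule.torsion D M :=
      ⟨⟨a, mem_nonZeroDivisors_of_ne_zero ha⟩, hax⟩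
    have := Submodule.mem_annihilator.1 hf ⟨x, hx⟩ trivial
    simpa using congrArg Subtype.val this
  refine ⟨f, nonZeroDivisors.ne_zero hf0, fun d hd hdf => ⟨fun x hx => ?_, ?_⟩⟩
  · obtain ⟨u, v, huv⟩ := (hd.irreducible.coprime_iff_not_dvd).2 hdf
    rw [← one_smul D x, ← huv, add_smul, mul_smul, mul_smul, hx, hann x d hd.ne_zero hx]
    simp
  · by_cases hdiv : ∃ y : M, ∀ x : M, d • x ≠ y
    · exact Or.inr hdiv
    · left
      push Not at hdiv
      obtain ⟨r, hr, hr'⟩ := Submodule.exists_sub_one_mem_and_smul_eq_zero_of_fg_of_le_smul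
        (Ideal.span {d}) (⊤ : Submodule D M) Module.Finite.fg_top (by
          intro y _
          obtain ⟨x, rfl⟩ := hdiv y
          exact Submodule.smul_mem_smul (Ideal.mem_span_singleton_self d) trivial)
      intro x
      refine hann x r ?_ (hr' x trivial)
      rintro rfl
      rw [Ideal.mem_span_singleton, zero_sub, dvd_neg] at hr
      exact hd.not_isUnit (isUnit_of_dvd_one hr)

theorem exists_genericFactor_of_fg [IsDomain D] [IsPrincipalIdealRing D] (A B : Submodule D M)
    (hB : B.FG) : ∃ f : D, f ≠ 0 ∧ GenericFactor f A B := by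
  have : Module.Finite D B := Module.Finite.iff_fg.2 hB
  obtain ⟨f, hf, h⟩ :=
    exists_ne_zero_forall_prime_of_finite (D := D) (M := ↥B ⧸ A.comap B.subtype)
  have hz : ∀ b : B, Submodule.Quotient.mk (p := A.comap B.subtype) b = 0 ↔ (b : M) ∈ A := by
    intro b
    rw [Submodule.Quotient.mk_eq_zero]
    rfl
  refine ⟨f, hf, fun d hd hdf => ?_⟩
  obtain ⟨h1, h2⟩ := h d hd hdf
  refine ⟨fun x hx hdx => ?_, h2.imp ?_ ?_⟩
  · refine (hz ⟨x, hx⟩).1 (h1 _ ?_)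
    rw [← Submodule.Quotient.mk_smul, hz]
    exact hdx
  · intro h3 x hx
    refine ⟨1, ?_⟩
    have := h3 (Submodule.Quotient.mk ⟨x, hx⟩)
    rw [← Submodule.Quotient.mk_smul, hz] at this
    simpa using this
  · rintro ⟨y, hy⟩
    obtain ⟨y, rfl⟩ := Submodule.Quotient.mk_surjective _ y
    refine ⟨y, y.2, fun x hx hxy => hy (Submodule.Quotient.mk ⟨x, hx⟩) ?_⟩
    rw [← sub_eq_zero, ← Submodule.Quotient.mk_smul, ← Submodule.Quotient.mk_sub, hz]
    exact hxy

theorem smul_orbitSpan (H : Subgroup Γ) (s : Set M) (g : Γ) (hg : g ∈ H) :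
    g • orbitSpan D H s = orbitSpan D H s := by
  rw [orbitSpan, Submodule.pointwise_smul_def, Submodule.map_span]
  congr 1
  change g • ((H : Set Γ) • s) = _
  rw [← smul_assoc, smul_coe_set hg]

theorem orbitSpan_le {H : Subgroup Γ} {s : Set M} {B : Submodule D M}
    (hB : H ≤ MulAction.stabilizer Γ B) (hs : s ⊆ B) : orbitSpan D H s ≤ B := by
  refine Submodule.span_le.2 ?_
  rintro _ ⟨h, hh, x, hx, rfl⟩
  have := Submodule.smul_mem_pointwise_smul x h B (hs hx)
  rwa [MulAction.mem_stabilizer_iff.1 (hB hh)] at this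

variable (D M) in
/-- Finitely generated `H`-submodules of `M` satisfy the ascending chain condition on
`H`-submodules. -/
def OrbitNoetherian (H : Subgroup Γ) : Prop :=
  ∀ s : Set M, s.Finite → ∀ C : ℕ → Submodule D M, Monotone C →
    (∀ n, H ≤ MulAction.stabilizer Γ (C n)) → (∀ n, C n ≤ orbitSpan D H s) →
    ∃ n, ∀ m, n ≤ m → C m = C n

variable (D M) in
/-- Every quotient of a finitely generated `H`-submodule of `M` is generically torsion-free and
non-divisible. -/
def OrbitGeneric (H : Subgroup Γ) : Prop :=
  ∀ s : Set M, s.Finite → ∀ A : Submodule D M, H ≤ MulAction.stabilizer Γ A →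
    A ≤ orbitSpan D H s → ∃ f : D, f ≠ 0 ∧ GenericFactor f A (orbitSpan D H s)

theorem OrbitNoetherian.bot [IsNoetherianRing D] : OrbitNoetherian D M (⊥ : Subgroup Γ) := by
  intro s hs C hC _ hle
  rw [orbitSpan_bot] at hle
  have : IsNoetherian D (Submodule.span D s) :=
    isNoetherian_of_fg_of_noetherian _ (Submodule.fg_span hs)
  obtain ⟨n, hn⟩ := monotone_stabilizes_iff_noetherian.2 this
    ⟨fun n => (C n).comap (Submodule.span D s).subtype, fun i j h => Submodule.comap_mono (hC h)⟩
  refine ⟨n, fun m hm => ?_⟩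
  have := congrArg (Submodule.map (Submodule.span D s).subtype) (hn m hm)
  change Submodule.map _ (Submodule.comap _ (C n)) = Submodule.map _ (Submodule.comap _ (C m)) at this
  rw [Submodule.map_comap_subtype, Submodule.map_comap_subtype, inf_eq_right.2 (hle _),
    inf_eq_right.2 (hle _)] at this
  exact this.symm

theorem OrbitGeneric.bot [IsDomain D] [IsPrincipalIdealRing D] :
    OrbitGeneric D M (⊥ : Subgroup Γ) := by
  intro s hs A _ _
  rw [orbitSpan_bot]
  exact exists_genericFactor_of_fg _ _ (Submodule.fg_span hs)

/-- The partial sums `A + B + t B + ⋯ + t ^ (n - 1) B`. -/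
def translateSum (t : Γ) (A B : Submodule D M) : ℕ → Submodule D M
  | 0 => A
  | n + 1 => translateSum t A B n ⊔ t ^ n • B

theorem translateSum_mono (t : Γ) (A B : Submodule D M) : Monotone (translateSum t A B) :=
  monotone_nat_of_le_succ fun _ => le_sup_left

theorem smul_translateSum_le (t : Γ) {A B : Submodule D M} (hA : t • A = A) (n : ℕ) :
    t • translateSum t A B n ≤ translateSum t A B (n + 1) := by
  induction n with
  | zero => exact hA.le.trans le_sup_left
  | succ n ih =>
    rw [translateSum, Submodule.smul_sup', ← mul_smul, ← pow_succ']
    exact sup_le_sup_right ih _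

theorem translateSum_succ_le (t : Γ) {A B : Submodule D M} (hA : t • A = A) (n : ℕ) :
    translateSum t A B (n + 1) ≤ t • translateSum t A B n ⊔ B := by
  induction n with
  | zero => simp [translateSum, hA]
  | succ n ih =>
    conv_lhs => rw [translateSum]
    conv_rhs => rw [translateSum]
    rw [Submodule.smul_sup', ← mul_smul, ← pow_succ', sup_right_comm]
    exact sup_le_sup_right ih _

theorem le_stabilizer_smul {H : Subgroup Γ} [H.Normal] {B : Submodule D M}
    (hB : H ≤ MulAction.stabilizer Γ B) (g : Γ) : H ≤ MulAction.stabilizer Γ (g • B) := by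
  intro h hh
  have := MulAction.mem_stabilizer_iff.1 (hB (‹H.Normal›.conj_mem' h hh g))
  rw [MulAction.mem_stabilizer_iff]
  conv_rhs => rw [← this]
  simp only [← mul_smul]
  congr 1
  group

theorem le_stabilizer_sup {H : Subgroup Γ} {A B : Submodule D M}
    (hA : H ≤ MulAction.stabilizer Γ A) (hB : H ≤ MulAction.stabilizer Γ B) :
    H ≤ MulAction.stabilizer Γ (A ⊔ B) := by
  intro h hh
  rw [MulAction.mem_stabilizer_iff, Submodule.smul_sup', MulAction.mem_stabilizer_iff.1 (hA hh),
    MulAction.mem_stabilizer_iff.1 (hB hh)]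

theorem le_stabilizer_of_forall {H : Subgroup Γ} {A : Submodule D M}
    (h : ∀ g ∈ H, ∀ a ∈ A, g • a ∈ A) : H ≤ MulAction.stabilizer Γ A := by
  intro g hg
  rw [MulAction.mem_stabilizer_iff]
  refine le_antisymm ?_ ?_
  · intro x hx
    obtain ⟨a, ha, rfl⟩ := (Submodule.mem_smul_pointwise_iff_exists _ _ _).1 hx
    exact h g hg a ha
  · intro x hx
    rw [← inv_inv g, Submodule.mem_inv_smul_iff_of_group]
    exact h _ (H.inv_mem hg) x hx

theorem smul_mem_of_le_stabilizer {H : Subgroup Γ} {A : Submodule D M}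
    (h : H ≤ MulAction.stabilizer Γ A) {g : Γ} (hg : g ∈ H) {a : M} (ha : a ∈ A) : g • a ∈ A := by
  have := Submodule.smul_mem_pointwise_smul a g A ha
  rwa [MulAction.mem_stabilizer_iff.1 (h hg)] at this

theorem le_stabilizer_inf {H : Subgroup Γ} {A B : Submodule D M}
    (hA : H ≤ MulAction.stabilizer Γ A) (hB : H ≤ MulAction.stabilizer Γ B) :
    H ≤ MulAction.stabilizer Γ (A ⊓ B) :=
  le_stabilizer_of_forall fun _ hg _ ha =>
    ⟨smul_mem_of_le_stabilizer hA hg ha.1, smul_mem_of_le_stabilizer hB hg ha.2⟩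

theorem le_stabilizer_iSup {ι : Sort*} {H : Subgroup Γ} {A : ι → Submodule D M}
    (hA : ∀ i, H ≤ MulAction.stabilizer Γ (A i)) :
    H ≤ MulAction.stabilizer Γ (⨆ i, A i) := by
  intro h hh
  rw [MulAction.mem_stabilizer_iff, Submodule.smul_iSup']
  exact iSup_congr fun i => MulAction.mem_stabilizer_iff.1 (hA i hh)

theorem le_stabilizer_translateSum {H : Subgroup Γ} [H.Normal] {A B : Submodule D M}
    (hA : H ≤ MulAction.stabilizer Γ A) (hB : H ≤ MulAction.stabilizer Γ B) (t : Γ) (n : ℕ) :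
    H ≤ MulAction.stabilizer Γ (translateSum t A B n) := by
  induction n with
  | zero => exact hA
  | succ n ih => exact le_stabilizer_sup ih (le_stabilizer_smul hB _)

theorem smul_iSup_translateSum_le (t : Γ) {A : Submodule D M} (B : Submodule D M)
    (hA : t • A = A) : t • ⨆ n, translateSum t A B n ≤ ⨆ n, translateSum t A B n := by
  rw [Submodule.smul_iSup']
  exact iSup_le fun n => (smul_translateSum_le t hA n).trans (le_iSup (translateSum t A B) (n + 1))

theorem monotone_inv_pow_smul (t : Γ) {B : Submodule D M} (hB : t • B ≤ B) :
    Monotone fun k : ℕ => (t⁻¹) ^ k • B := by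
  refine monotone_nat_of_le_succ fun k x hx => ?_
  simp only [inv_pow, Submodule.mem_inv_smul_iff_of_group] at hx ⊢
  rw [pow_succ', mul_smul]
  exact hB (Submodule.smul_mem_pointwise_smul _ _ _ hx)

theorem orbitSpan_sup_zpowers_le {H : Subgroup Γ} [H.Normal] (s : Set M) (t : Γ)
    {A : Submodule D M} (hA : H ≤ MulAction.stabilizer Γ A) (htA : t • A = A) :
    orbitSpan D (H ⊔ Subgroup.zpowers t) s ≤
      ⨆ k : ℕ, (t⁻¹) ^ k • ⨆ n, translateSum t A (orbitSpan D H s) n := by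
  set L := ⨆ n, translateSum t A (orbitSpan D H s) n with hL
  have hmono := monotone_inv_pow_smul t (smul_iSup_translateSum_le t (orbitSpan D H s) htA)
  have hsL : s ⊆ L := fun x hx =>
    (le_sup_right.trans (le_iSup (translateSum t A (orbitSpan D H s)) 1) :
      t ^ 0 • orbitSpan D H s ≤ L) (by simpa using subset_orbitSpan H s hx)
  refine orbitSpan_le (sup_le ?_ ?_) fun x hx =>
    (le_iSup (fun k : ℕ => (t⁻¹) ^ k • L) 0) (by simpa using hsL hx)
  · exact le_stabilizer_iSup fun k => le_stabilizer_smul (le_stabilizer_iSup fun n =>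
      le_stabilizer_translateSum hA (fun h hh => smul_orbitSpan H s h hh) t n) _
  · rw [Subgroup.zpowers_le, ← inv_mem_iff, MulAction.mem_stabilizer_iff, Submodule.smul_iSup']
    refine Eq.trans ?_ (hmono.iSup_nat_add 1)
    exact iSup_congr fun k => by rw [← mul_smul, ← pow_succ']

theorem OrbitNoetherian.sup_zpowers {H : Subgroup Γ} [H.Normal] (hH : OrbitNoetherian D M H)
    (t : Γ) : OrbitNoetherian D M (H ⊔ Subgroup.zpowers t) := by
  intro s hs C hC hinv hle
  set B := orbitSpan D H s with hBdef
  have hB : H ≤ MulAction.stabilizer Γ B := fun h hh => smul_orbitSpan H s h hh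
  have hbot : H ≤ MulAction.stabilizer Γ (⊥ : Submodule D M) := fun h _ => by simp
  set L := translateSum t ⊥ B with hLdef
  have hLmono : Monotone L := translateSum_mono t ⊥ B
  have htC : ∀ j, t ∈ MulAction.stabilizer Γ (C j) := fun j =>
    hinv j (Subgroup.mem_sup_right (Subgroup.mem_zpowers t))
  let I : ℕ → ℕ → Submodule D M := fun n j => (t ^ n)⁻¹ • (C j ⊔ L n) ⊓ B
  have hmemI : ∀ n j x, x ∈ I n j ↔ t ^ n • x ∈ C j ⊔ L n ∧ x ∈ B := fun n j x => by
    rw [Submodule.mem_inf, Submodule.mem_inv_smul_iff_of_group]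
  have hIj : ∀ n, Monotone (I n) := fun n i j hij x hx => by
    rw [hmemI] at hx ⊢
    exact ⟨sup_le_sup_right (hC hij) _ hx.1, hx.2⟩
  have hIn : ∀ j, Monotone fun n => I n j := fun j => by
    refine monotone_nat_of_le_succ fun n x hx => ?_
    rw [hmemI] at hx ⊢
    refine ⟨?_, hx.2⟩
    rw [pow_succ', mul_smul]
    have := Submodule.smul_mem_pointwise_smul _ t _ hx.1
    rw [Submodule.smul_sup', MulAction.mem_stabilizer_iff.1 (htC j)] at this
    exact sup_le_sup_left (smul_translateSum_le t (Submodule.smul_bot' t) n) (C j) this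
  have hIinv : ∀ n j, H ≤ MulAction.stabilizer Γ (I n j) := fun n j =>
    le_stabilizer_inf (le_stabilizer_smul (le_stabilizer_sup (le_sup_left.trans (hinv j))
      (le_stabilizer_translateSum hbot hB t n)) _) hB
  obtain ⟨n₀, hn₀⟩ := hH s hs (fun n => I n n)
    (fun i j hij => (hIj i hij).trans (hIn j hij)) (fun n => hIinv n n) fun n => inf_le_right
  choose J hJ using fun n => hH s hs (I n) (hIj n) (hIinv n) fun j => inf_le_right
  let N := n₀ + ∑ n ∈ Finset.range n₀, J n
  have hstab : ∀ n j, N ≤ j → I n j ≤ I n N := by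
    intro n j hj
    rcases lt_or_ge n n₀ with hn | hn
    · have hJN : J n ≤ N := (Finset.single_le_sum (f := J) (fun _ _ => Nat.zero_le _)
        (Finset.mem_range.2 hn)).trans (Nat.le_add_left _ _)
      rw [hJ n j (hJN.trans hj), hJ n N hJN]
    · have h0N : n₀ ≤ N := Nat.le_add_right _ _
      calc I n j ≤ I (max n j) (max n j) :=
            (hIj n (le_max_right n j)).trans (hIn _ (le_max_left n j))
        _ = I n₀ n₀ := hn₀ _ (hn.trans (le_max_left n j))
        _ ≤ I n N := (hIj n₀ h0N).trans (hIn N hn)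
  refine ⟨N, fun j hj => le_antisymm ?_ (hC hj)⟩
  have key : ∀ n, ∀ c ∈ C j, c ∈ L n → c ∈ C N := by
    intro n
    induction n with
    | zero =>
      intro c _ hc
      rw [(Submodule.mem_bot D).1 hc]
      exact zero_mem _
    | succ n ih =>
      intro c hc hcL
      obtain ⟨l, hl, y, hy, rfl⟩ := Submodule.mem_sup.1 hcL
      obtain ⟨m, hm, rfl⟩ := (Submodule.mem_smul_pointwise_iff_exists _ _ _).1 hy
      have hmI : m ∈ I n j := by
        rw [hmemI]
        refine ⟨?_, hm⟩
        have := (C j ⊔ L n).sub_mem (Submodule.mem_sup_left hc) (Submodule.mem_sup_right hl)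
        rwa [add_sub_cancel_left] at this
      obtain ⟨c', hc', l', hl', hcl⟩ := Submodule.mem_sup.1 ((hmemI _ _ _).1 (hstab n j hj hmI)).1
      have hll : l + l' ∈ C N := by
        refine ih _ ?_ ((L n).add_mem hl hl')
        have := (C j).sub_mem hc (hC hj hc')
        rwa [← hcl, show l + (c' + l') - c' = l + l' by abel] at this
      rw [← hcl, show l + (c' + l') = c' + (l + l') by abel]
      exact (C N).add_mem hc' hll
  intro c hc
  have htop := orbitSpan_sup_zpowers_le s t hbot (by simp) (hle j hc)
  obtain ⟨k, hk⟩ := (Submodule.mem_iSup_of_directed _ (monotone_inv_pow_smul t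
    (smul_iSup_translateSum_le t B (by simp))).directed_le).1 htop
  rw [inv_pow, Submodule.mem_inv_smul_iff_of_group] at hk
  obtain ⟨n, hn⟩ := (Submodule.mem_iSup_of_directed _ hLmono.directed_le).1 hk
  have hkC : ∀ i x, t ^ k • x ∈ C i ↔ x ∈ C i := fun i x => by
    have := MulAction.mem_stabilizer_iff.1 (pow_mem (htC i) k)
    conv_lhs => rw [← this]
    rw [Submodule.smul_mem_smul_iff_of_group]
  exact (hkC N c).1 (key n _ ((hkC j c).2 hc) hn)

theorem OrbitGeneric.sup_zpowers [IsDomain D] {H : Subgroup Γ} [H.Normal]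
    (hN : OrbitNoetherian D M H) (hH : OrbitGeneric D M H) (t : Γ) :
    OrbitGeneric D M (H ⊔ Subgroup.zpowers t) := by
  intro s hs A hA hAle
  set B := orbitSpan D H s with hBdef
  have hB : H ≤ MulAction.stabilizer Γ B := fun h hh => smul_orbitSpan H s h hh
  have hHA : H ≤ MulAction.stabilizer Γ A := le_sup_left.trans hA
  have htS : t ∈ H ⊔ Subgroup.zpowers t := Subgroup.mem_sup_right (Subgroup.mem_zpowers t)
  have htA : t • A = A := MulAction.mem_stabilizer_iff.1 (hA htS)
  set L := translateSum t A B with hLdef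
  have hLmono : Monotone L := translateSum_mono t A B
  have hLinv : ∀ n, H ≤ MulAction.stabilizer Γ (L n) := le_stabilizer_translateSum hHA hB t
  set U := ⨆ n, L n with hU
  have htU : t • U ≤ U := smul_iSup_translateSum_le t B htA
  let K : ℕ → Submodule D M := fun n => (t ^ n)⁻¹ • L n ⊓ B
  have hKinv : ∀ n, H ≤ MulAction.stabilizer Γ (K n) := fun n =>
    le_stabilizer_inf (le_stabilizer_smul (hLinv n) _) hB
  have hKmono : Monotone K := by
    refine monotone_nat_of_le_succ fun n x hx => ?_
    rw [Submodule.mem_inf, Submodule.mem_inv_smul_iff_of_group] at hx ⊢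
    refine ⟨?_, hx.2⟩
    rw [pow_succ', mul_smul]
    exact smul_translateSum_le t htA n (Submodule.smul_mem_pointwise_smul _ t _ hx.1)
  obtain ⟨n₀, hn₀⟩ := hN s hs K hKmono hKinv fun n => inf_le_right
  choose F hF0 hF using fun n => hH s hs (K n) (hKinv n) inf_le_right
  obtain ⟨g, hg0, hg⟩ := hH s hs (t • U ⊓ B)
    (le_stabilizer_inf (le_stabilizer_smul (le_stabilizer_iSup hLinv) t) hB) inf_le_right
  let f := g * ∏ n ∈ Finset.range (n₀ + 1), F n
  refine ⟨f, mul_ne_zero hg0 (Finset.prod_ne_zero_iff.2 fun n _ => hF0 n), ?_⟩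
  have hfK : ∀ n, GenericFactor f (K n) B := by
    intro n
    rcases le_or_gt n n₀ with hn | hn
    · exact (hF n).of_dvd ((Finset.dvd_prod_of_mem F
        (Finset.mem_range.2 (Nat.lt_succ_of_le hn))).trans (dvd_mul_left _ _))
    · rw [hn₀ n hn.le]
      exact (hF n₀).of_dvd ((Finset.dvd_prod_of_mem F
        (Finset.mem_range.2 (Nat.lt_succ_self _))).trans (dvd_mul_left _ _))
  have hAU : GenericFactor f A U := by
    refine GenericFactor.iSup L hLmono fun n => GenericFactor.sup ?_
    have := (hfK n).smul (t ^ n)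
    convert this using 1
    ext x
    rw [← inv_inv (t ^ n), Submodule.mem_inv_smul_iff_of_group, Submodule.mem_inf,
      Submodule.mem_inf, Submodule.mem_inv_smul_iff_of_group, Submodule.mem_inv_smul_iff_of_group]
    simp
  have hUB : U = t • U ⊔ B := by
    refine le_antisymm (iSup_le fun n => ?_) (sup_le htU ?_)
    · exact (hLmono (Nat.le_succ n)).trans ((translateSum_succ_le t htA n).trans
        (sup_le_sup_right (smul_mono_right t (le_iSup L n)) _))
    · refine le_trans ?_ (le_iSup L 1)
      simp [hLdef, translateSum]
  have htUU : GenericFactor f (t • U) U := by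
    have := (hg.of_dvd (dvd_mul_right g (∏ n ∈ Finset.range (n₀ + 1), F n))).sup
    rwa [← hUB] at this
  let N : ℕ → Submodule D M := fun k => Nat.rec A (fun k _ => (t⁻¹) ^ k • U) k
  have hmono := monotone_inv_pow_smul t htU
  have hNmono : Monotone N := by
    refine monotone_nat_of_le_succ fun k => ?_
    cases k with
    | zero =>
      change A ≤ (t⁻¹) ^ 0 • U
      rw [pow_zero, one_smul]
      exact le_iSup L 0
    | succ k => exact hmono (Nat.le_succ k)
  have hfin : orbitSpan D (H ⊔ Subgroup.zpowers t) s = ⨆ k, N k := by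
    refine le_antisymm ?_ (iSup_le fun k => ?_)
    · exact (orbitSpan_sup_zpowers_le s t hHA htA).trans
        (iSup_le fun k => le_iSup N (k + 1))
    · cases k with
      | zero => exact hAle
      | succ k =>
        have hst : ∀ g ∈ H ⊔ Subgroup.zpowers t, ∀ X ≤ orbitSpan D (H ⊔ Subgroup.zpowers t) s,
            g • X ≤ orbitSpan D (H ⊔ Subgroup.zpowers t) s := fun g hg X hX =>
          (smul_mono_right g hX).trans (smul_orbitSpan _ s g hg).le
        refine hst _ (pow_mem (inv_mem htS) k) _ (iSup_le fun n => ?_)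
        induction n with
        | zero => exact hAle
        | succ n ih => exact sup_le ih (hst _ (pow_mem htS n) _ (orbitSpan_mono le_sup_left s))
  rw [hfin]
  refine GenericFactor.iSup N hNmono fun k => ?_
  cases k with
  | zero => simpa [N] using hAU
  | succ k =>
    have := htUU.smul ((t⁻¹) ^ (k + 1))
    convert this using 1
    simp [N, pow_succ, mul_smul]

/-- Subgroups with a finite chain from the trivial subgroup whose factors are cyclic and central
in the ambient group. -/
inductive CyclicCentralChain : Subgroup Γ → Prop
  | bot : CyclicCentralChain ⊥
  | sup_zpowers (H : Subgroup Γ) (t : Γ) : CyclicCentralChain H → (∀ g, ⁅t, g⁆ ∈ H) →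
      CyclicCentralChain (H ⊔ Subgroup.zpowers t)

theorem Subgroup.Normal.sup_zpowers_of_commutator_mem {H : Subgroup Γ} (hH : H.Normal) {t : Γ}
    (ht : ∀ g, ⁅t, g⁆ ∈ H) : (H ⊔ Subgroup.zpowers t).Normal := by
  refine ⟨fun x hx g => ?_⟩
  obtain ⟨h, hh, y, hy, rfl⟩ := Subgroup.mem_sup_of_normal_left.1 hx
  obtain ⟨n, rfl⟩ := Subgroup.mem_zpowers_iff.1 hy
  have hgt : g * t * g⁻¹ ∈ H ⊔ Subgroup.zpowers t := by
    rw [show g * t * g⁻¹ = ⁅t, g⁆⁻¹ * t by rw [commutatorElement_def]; group]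
    exact mul_mem (Subgroup.mem_sup_left (inv_mem (ht g)))
      (Subgroup.mem_sup_right (Subgroup.mem_zpowers t))
  rw [← conj_mul, ← conj_zpow]
  exact mul_mem (Subgroup.mem_sup_left (hH.conj_mem h hh g)) (zpow_mem hgt n)

theorem CyclicCentralChain.normal {H : Subgroup Γ} (h : CyclicCentralChain H) : H.Normal := by
  induction h with
  | bot => infer_instance
  | sup_zpowers H t _ ht ih => exact ih.sup_zpowers_of_commutator_mem ht

theorem CyclicCentralChain.orbitNoetherian [IsNoetherianRing D] {H : Subgroup Γ}
    (h : CyclicCentralChain H) : OrbitNoetherian D M H := by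
  induction h with
  | bot => exact OrbitNoetherian.bot
  | sup_zpowers H t hH _ ih =>
    have := hH.normal
    exact ih.sup_zpowers t

theorem CyclicCentralChain.orbitGeneric [IsDomain D] [IsPrincipalIdealRing D] {H : Subgroup Γ}
    (h : CyclicCentralChain H) : OrbitGeneric D M H := by
  induction h with
  | bot => exact OrbitGeneric.bot
  | sup_zpowers H t hH _ ih =>
    have := hH.normal
    exact OrbitGeneric.sup_zpowers hH.orbitNoetherian ih t
end

section
variable {Γ : Type*} [Group Γ]

theorem CyclicCentralChain.sup_closure {H : Subgroup Γ} (hH : CyclicCentralChain H) {T : Set Γ}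
    (hT : T.Finite) (h : ∀ t ∈ T, ∀ g, ⁅t, g⁆ ∈ H) :
    CyclicCentralChain (H ⊔ Subgroup.closure T) := by
  induction T, hT using Set.Finite.induction_on with
  | empty => simpa using hH
  | @insert a T _ _ ih =>
    have := CyclicCentralChain.sup_zpowers _ a (ih fun t ht => h t (Set.mem_insert_of_mem _ ht))
      fun g => Subgroup.mem_sup_left (h a (Set.mem_insert _ _) g)
    rwa [Set.insert_eq, Subgroup.closure_union, ← Subgroup.zpowers_eq_closure,
      sup_comm (Subgroup.zpowers a), ← sup_assoc]

theorem commutatorElement_mem_iff_commute {K : Subgroup Γ} [K.Normal] (a b : Γ) :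
    ⁅a, b⁆ ∈ K ↔ Commute (a : Γ ⧸ K) (b : Γ ⧸ K) := by
  rw [← commutatorElement_eq_one_iff_commute, ← QuotientGroup.eq_one_iff]
  rfl

theorem exists_finite_lowerCentralSeries_eq_sup_closure [hfg : Group.FG Γ] (i : ℕ) :
    ∃ T : Set Γ, T.Finite ∧ (⊤ : Subgroup Γ).lowerCentralSeries i =
      (⊤ : Subgroup Γ).lowerCentralSeries (i + 1) ⊔ Subgroup.closure T := by
  obtain ⟨T, hT, hTfin⟩ := Group.fg_iff.1 hfg
  induction i with
  | zero => exact ⟨T, hTfin, by simp [hT]⟩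
  | succ i ih =>
    obtain ⟨S, hS, hSeq⟩ := ih
    set γ := (⊤ : Subgroup Γ).lowerCentralSeries with hγ
    have hsucc : ∀ n, γ (n + 1) = ⁅γ n, (⊤ : Subgroup Γ)⁆ := fun n =>
      Subgroup.lowerCentralSeries_succ _ n
    have hcomm : ∀ n, ∀ a ∈ γ n, ∀ g, ⁅a, g⁆ ∈ γ (n + 1) := fun n a ha g => by
      rw [hsucc]
      exact Subgroup.commutator_mem_commutator ha (Subgroup.mem_top g)
    have hanti : Antitone γ := Subgroup.lowerCentralSeries_antitone _
    have hSi : ∀ s ∈ S, s ∈ γ i := fun s hs => by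
      rw [hSeq]
      exact Subgroup.mem_sup_right (Subgroup.subset_closure hs)
    refine ⟨Set.image2 (fun s t => ⁅s, t⁆) S T, hS.image2 _ hTfin, ?_⟩
    set K := γ (i + 1 + 1) ⊔ Subgroup.closure (Set.image2 (fun s t => ⁅s, t⁆) S T) with hK
    have hKle : K ≤ γ (i + 1) := by
      refine sup_le (hanti (Nat.le_succ _)) ((Subgroup.closure_le _).2 ?_)
      rintro _ ⟨s, hs, t, _, rfl⟩
      exact hcomm i s (hSi s hs) t
    have hKn : K.Normal := by
      refine ⟨fun k hk g => ?_⟩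
      rw [show g * k * g⁻¹ = ⁅k, g⁆⁻¹ * k by rw [commutatorElement_def]; group]
      exact mul_mem (inv_mem (Subgroup.mem_sup_left (hcomm _ k (hKle hk) g))) hk
    refine le_antisymm ?_ hKle
    have hcen : γ i ≤ (Subgroup.center (Γ ⧸ K)).comap (QuotientGroup.mk' K) := by
      rw [hSeq]
      refine sup_le (fun a ha => ?_) ((Subgroup.closure_le _).2 fun s hs => ?_)
      · refine Subgroup.mem_center_iff.2 fun q => ?_
        obtain ⟨g, rfl⟩ := QuotientGroup.mk_surjective q
        exact ((commutatorElement_mem_iff_commute a g).1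
          (Subgroup.mem_sup_left (hcomm _ a ha g))).symm
      · refine Subgroup.mem_center_iff.2 fun q => ?_
        obtain ⟨g, rfl⟩ := QuotientGroup.mk_surjective q
        have hle : Subgroup.closure T ≤
            (Subgroup.centralizer {(s : Γ ⧸ K)}).comap (QuotientGroup.mk' K) := by
          refine (Subgroup.closure_le _).2 fun t ht => Subgroup.mem_centralizer_singleton_iff.2 ?_
          exact ((commutatorElement_mem_iff_commute s t).1
            (Subgroup.mem_sup_right (Subgroup.subset_closure (Set.mem_image2_of_mem hs ht)))).symm
        rw [hT] at hle
        exact Subgroup.mem_centralizer_singleton_iff.1 (hle (Subgroup.mem_top g))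
    rw [hsucc, Subgroup.commutator_le]
    intro a ha g _
    exact (commutatorElement_mem_iff_commute a g).2
      (Subgroup.mem_center_iff.1 (hcen ha) (g : Γ ⧸ K)).symm

theorem CyclicCentralChain.top_of_fg_of_isNilpotent [Group.FG Γ] [hnil : Group.IsNilpotent Γ] :
    CyclicCentralChain (⊤ : Subgroup Γ) := by
  obtain ⟨n, hn⟩ := Subgroup.nilpotent_iff_lowerCentralSeries.1 hnil
  have key : ∀ k ≤ n, CyclicCentralChain ((⊤ : Subgroup Γ).lowerCentralSeries (n - k)) := by
    intro k
    induction k with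
    | zero => intro _; rw [Nat.sub_zero, hn]; exact CyclicCentralChain.bot
    | succ k ih =>
      intro hk
      obtain ⟨T, hT, hTeq⟩ := exists_finite_lowerCentralSeries_eq_sup_closure (Γ := Γ) (n - (k + 1))
      have hk' : n - (k + 1) + 1 = n - k := by omega
      rw [hk'] at hTeq
      have hTmem : ∀ t ∈ T, t ∈ (⊤ : Subgroup Γ).lowerCentralSeries (n - (k + 1)) := fun t ht => by
        rw [hTeq]
        exact Subgroup.mem_sup_right (Subgroup.subset_closure ht)
      rw [hTeq]
      refine (ih (by omega)).sup_closure hT fun t ht g => ?_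
      rw [← hk', Subgroup.lowerCentralSeries_succ]
      exact Subgroup.commutator_mem_commutator (hTmem t ht) (Subgroup.mem_top g)
  simpa using key n le_rfl
end

section
open Polynomial

theorem exists_prime_not_bijective_smul {D M Γ : Type*} [CommRing D] [IsDomain D]
    [IsPrincipalIdealRing D] [AddCommGroup M] [Module D M] [Group Γ] [DistribMulAction Γ M]
    [SMulCommClass Γ D M] (hD : ∀ f : D, f ≠ 0 → ∃ d, Prime d ∧ ¬ d ∣ f)
    (hΓ : CyclicCentralChain (⊤ : Subgroup Γ)) (w : M) (hw : w ≠ 0)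
    (hspan : orbitSpan D (⊤ : Subgroup Γ) {w} = ⊤) :
    ∃ d : D, Prime d ∧ ¬ Function.Bijective fun x : M => d • x := by
  by_contra! hbij
  have hinj : ∀ a : D, a ≠ 0 → ∀ x : M, a • x = 0 → x = 0 := by
    intro a
    induction a using UniqueFactorizationMonoid.induction_on_prime with
    | h₁ => exact fun h => absurd rfl h
    | h₂ u hu => exact fun _ x hx => (hu.smul_eq_zero).1 hx
    | h₃ a p _ hp ih =>
      intro h x hx
      rw [mul_smul] at hx
      exact ih (right_ne_zero_of_mul h) x ((hbij p hp).1 (by simpa using hx))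
  obtain ⟨f, hf, h⟩ := hΓ.orbitGeneric (D := D) (M := M) {w} (Set.finite_singleton w) ⊥
    (fun g _ => by simp) bot_le
  obtain ⟨d, hd, hdf⟩ := hD f hf
  rw [hspan] at h
  rcases (h d hd hdf).2 with h' | ⟨y, _, hy⟩
  · obtain ⟨k, hk⟩ := h' w trivial
    exact hw (hinj _ (pow_ne_zero k hf) w hk)
  · obtain ⟨x, hx⟩ := (hbij d hd).2 y
    exact hy x trivial (by simpa [sub_eq_zero] using hx)

theorem map_aeval_apply {S W V : Type*} [CommRing S] [AddCommGroup W] [AddCommGroup V]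
    [Module S V] (x : Module.End ℤ W) (x' : Module.End S V) (j : W →+ V)
    (hj : ∀ w, j (x w) = x' (j w)) (u : ℤ[X]) (w : W) :
    j (aeval x u w) = aeval x' (u.map (Int.castRingHom S)) (j w) := by
  induction u using Polynomial.induction_on' with
  | add p q hp hq => simp [hp, hq]
  | monomial n a =>
    have hpow : ∀ w, j ((x ^ n) w) = (x' ^ n) (j w) := by
      induction n with
      | zero => simp
      | succ n ih => intro w; rw [pow_succ, pow_succ, Module.End.mul_apply, ih, hj]; rfl
    simp [aeval_monomial, hpow]

theorem eq_zero_or_bijective_of_simple {W Γ : Type*} [AddCommGroup W] [Group Γ]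
    [DistribMulAction Γ W]
    (hW : ∀ A : AddSubgroup W, (∀ (g : Γ), ∀ a ∈ A, g • a ∈ A) → A = ⊥ ∨ A = ⊤)
    (φ : W →+ W) (hφ : ∀ (g : Γ) w, φ (g • w) = g • φ w) :
    φ = 0 ∨ Function.Bijective φ := by
  rcases hW φ.ker fun g a ha => by
    rw [AddMonoidHom.mem_ker] at ha ⊢
    rw [hφ, ha, smul_zero] with hker | hker
  · rcases hW φ.range (by rintro g _ ⟨a, rfl⟩; exact ⟨g • a, hφ g a⟩) with hr | hr
    · left
      ext w
      have : φ w ∈ φ.range := ⟨w, rfl⟩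
      rwa [hr, AddSubgroup.mem_bot] at this
    · exact Or.inr ⟨(AddMonoidHom.ker_eq_bot_iff φ).1 hker, AddMonoidHom.range_eq_top.1 hr⟩
  · left
    ext w
    have : w ∈ φ.ker := by rw [hker]; trivial
    exact this

theorem orbitSpan_eq_top_of_simple {D W Γ : Type*} [CommRing D] [AddCommGroup W] [Module D W]
    [Group Γ] [DistribMulAction Γ W] [SMulCommClass Γ D W]
    (hW : ∀ A : AddSubgroup W, (∀ (g : Γ), ∀ a ∈ A, g • a ∈ A) → A = ⊥ ∨ A = ⊤)
    (w : W) (hw : w ≠ 0) : orbitSpan D (⊤ : Subgroup Γ) {w} = ⊤ := by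
  have hmem : w ∈ orbitSpan D (⊤ : Subgroup Γ) {w} := subset_orbitSpan _ _ rfl
  rcases hW (orbitSpan D (⊤ : Subgroup Γ) {w}).toAddSubgroup fun g a ha =>
    smul_mem_of_le_stabilizer (fun h hh => smul_orbitSpan ⊤ {w} h hh) (Subgroup.mem_top g) ha
    with h | h
  · refine absurd ?_ hw
    have : w ∈ (orbitSpan D (⊤ : Subgroup Γ) {w}).toAddSubgroup := hmem
    rwa [h, AddSubgroup.mem_bot] at this
  · refine eq_top_iff.2 fun x _ => ?_
    have : x ∈ (orbitSpan D (⊤ : Subgroup Γ) {w}).toAddSubgroup := by rw [h]; trivial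
    exact this

theorem exists_prime_not_dvd_int (f : ℤ) (hf : f ≠ 0) : ∃ d : ℤ, Prime d ∧ ¬ d ∣ f := by
  obtain ⟨p, hp, hprime⟩ := Nat.exists_infinite_primes (f.natAbs + 1)
  refine ⟨p, Nat.prime_iff_prime_int.1 hprime, fun h => ?_⟩
  have := Nat.le_of_dvd (Int.natAbs_pos.2 hf) (Int.natCast_dvd.1 h)
  omega

theorem exists_prime_not_dvd_polynomial {K : Type*} [Field K] (f : K[X]) (hf : f ≠ 0) :
    ∃ d : K[X], Prime d ∧ ¬ d ∣ f := by
  have hnu : ¬ IsUnit (X * f + 1 : K[X]) := by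
    intro h
    have h0 := natDegree_eq_zero_of_isUnit h
    rw [show (1 : K[X]) = C 1 by simp, natDegree_add_C, natDegree_X_mul hf] at h0
    omega
  have hne : (X * f + 1 : K[X]) ≠ 0 := by
    intro h
    have := congrArg (eval 0) h
    simp at this
  obtain ⟨d, hd, hdvd⟩ := WfDvdMonoid.exists_irreducible_factor hnu hne
  refine ⟨d, hd.prime, fun h => hd.not_isUnit (isUnit_of_dvd_one ?_)⟩
  exact (dvd_add_right (h.mul_left X)).1 hdvd

theorem exists_aeval_mul_self_eq_of_simple_of_field {K W Γ : Type*} [Field K] [AddCommGroup W]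
    [Module K W] [Group Γ] [DistribMulAction Γ W] [SMulCommClass Γ K W]
    (hΓ : CyclicCentralChain (⊤ : Subgroup Γ))
    (hW : ∀ A : AddSubgroup W, (∀ (g : Γ), ∀ a ∈ A, g • a ∈ A) → A = ⊥ ∨ A = ⊤)
    (x : Module.End K W) (hx : ∀ (g : Γ) w, x (g • w) = g • x w) (hx0 : x ≠ 0) :
    ∃ u : K[X], ∀ w, aeval x u (x w) = w := by
  obtain ⟨w, hxw⟩ : ∃ w, x w ≠ 0 := by
    by_contra! h
    exact hx0 (LinearMap.ext h)
  have hw : w ≠ 0 := by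
    rintro rfl
    exact hxw (map_zero x)
  have hcomm : ∀ (g : Γ) (q : K[X]) v, aeval x q (g • v) = g • aeval x q v := by
    intro g q
    have : Commute (DistribSMul.toLinearMap K W g) x :=
      LinearMap.ext fun v => (hx g v).symm
    have hq : Commute (DistribSMul.toLinearMap K W g) (aeval x q) :=
      Algebra.commute_of_mem_adjoin_singleton_of_commute (aeval_mem_adjoin_singleton K x) this
    exact fun v => (LinearMap.congr_fun hq v).symm
  let _ : Module K[X] W := Module.compHom W (aeval x).toRingHom
  have : SMulCommClass Γ K[X] W := ⟨fun g q v => (hcomm g q v).symm⟩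
  obtain ⟨d, hd, hdnb⟩ := exists_prime_not_bijective_smul (D := K[X])
    exists_prime_not_dvd_polynomial hΓ w hw (orbitSpan_eq_top_of_simple (D := K[X]) hW w hw)
  have hdW : aeval x d = 0 := by
    rcases eq_zero_or_bijective_of_simple (Γ := Γ) hW (aeval x d).toAddMonoidHom
      (fun g v => hcomm g d v) with h | h
    · exact LinearMap.ext fun v => DFunLike.congr_fun h v
    · exact absurd h hdnb
  have hc : d.coeff 0 ≠ 0 := by
    intro hc
    obtain ⟨s, hs⟩ : d ∣ X := (prime_X.associated_of_dvd hd (X_dvd_iff.2 hc)).symm.dvd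
    apply hxw
    rw [← aeval_X (R := K) x, hs, map_mul, hdW, zero_mul, LinearMap.zero_apply]
  refine ⟨C (-(d.coeff 0)⁻¹) * d.divX, fun v => ?_⟩
  have hid : C (-(d.coeff 0)⁻¹) * d.divX * X = 1 - C (d.coeff 0)⁻¹ * d := by
    conv_rhs => rw [← divX_mul_X_add d]
    have : (C (d.coeff 0)⁻¹ : K[X]) * C (d.coeff 0) = 1 := by
      rw [← C_mul, inv_mul_cancel₀ hc, C_1]
    simp only [coeff_add, coeff_mul_X_zero, coeff_C_zero, zero_add, mul_add, this, C_neg]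
    ring
  have := congrArg (fun q => aeval x q v) hid
  simpa [hdW] using this

theorem exists_aeval_mul_self_eq_of_simple {W Γ : Type*} [AddCommGroup W] [Group Γ]
    [DistribMulAction Γ W] (hΓ : CyclicCentralChain (⊤ : Subgroup Γ))
    (hW : ∀ A : AddSubgroup W, (∀ (g : Γ), ∀ a ∈ A, g • a ∈ A) → A = ⊥ ∨ A = ⊤)
    (x : Module.End ℤ W) (hx : ∀ (g : Γ) w, x (g • w) = g • x w) (hx0 : x ≠ 0) :
    ∃ u : ℤ[X], ∀ w, aeval x u (x w) = w := by
  obtain ⟨w, hw⟩ : ∃ w : W, w ≠ 0 := by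
    by_contra! h
    exact hx0 (LinearMap.ext fun w => h _)
  obtain ⟨a, ha, hanb⟩ := exists_prime_not_bijective_smul exists_prime_not_dvd_int hΓ w hw
    (orbitSpan_eq_top_of_simple (D := ℤ) hW w hw)
  have haW : ∀ v : W, a • v = 0 := by
    rcases eq_zero_or_bijective_of_simple (Γ := Γ) hW (zsmulAddGroupHom a)
      (fun g v => (smul_comm g a v).symm) with h | h
    · exact fun v => DFunLike.congr_fun h v
    · exact absurd h hanb
  have : Fact a.natAbs.Prime := ⟨Int.prime_iff_natAbs_prime.1 ha⟩
  have hpW : ∀ v : W, a.natAbs • v = 0 := fun v => by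
    rw [← natCast_zsmul]
    rcases Int.natAbs_eq a with h | h
    · rw [← h]; exact haW v
    · rw [← neg_eq_zero, ← neg_smul, ← h]; exact haW v
  let : Module (ZMod a.natAbs) W := AddCommGroup.zmodModule hpW
  have : SMulCommClass Γ (ZMod a.natAbs) W := ⟨fun g c v =>
    ZMod.map_smul (DistribSMul.toAddMonoidHom W g) c v⟩
  obtain ⟨u', hu'⟩ := exists_aeval_mul_self_eq_of_simple_of_field (K := ZMod a.natAbs) hΓ hW
    (AddMonoidHom.toZModLinearMap a.natAbs x.toAddMonoidHom) hx
    (fun h => hx0 (LinearMap.ext fun v => LinearMap.congr_fun h v))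
  obtain ⟨u, rfl⟩ := Polynomial.map_surjective (Int.castRingHom (ZMod a.natAbs))
    (ZMod.ringHom_surjective _) u'
  exact ⟨u, fun v => (map_aeval_apply x
    (AddMonoidHom.toZModLinearMap a.natAbs x.toAddMonoidHom) (AddMonoidHom.id W)
    (fun _ => rfl) u (x v)).trans (hu' v)⟩
end

section
variable {V Γ : Type*} [AddCommGroup V] [Group Γ] [DistribMulAction Γ V]

variable (Γ) in
/-- The subgroup `[B, Γ]` generated by the differences `g • b - b`. -/
def commutatorSpan (B : Submodule ℤ V) : Submodule ℤ V :=
  Submodule.span ℤ {y | ∃ g : Γ, ∃ b ∈ B, y = g • b - b}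

theorem commutatorSpan_mono {B C : Submodule ℤ V} (h : B ≤ C) :
    commutatorSpan Γ B ≤ commutatorSpan Γ C := by
  refine Submodule.span_mono ?_
  rintro _ ⟨g, b, hb, rfl⟩
  exact ⟨g, b, h hb, rfl⟩

theorem sub_mem_commutatorSpan (g : Γ) {B : Submodule ℤ V} {b : V} (hb : b ∈ B) :
    g • b - b ∈ commutatorSpan Γ B :=
  Submodule.subset_span ⟨g, b, hb, rfl⟩

variable (Γ) in
/-- The endomorphisms of `V` that preserve all invariant submodules of `B` and commute with the
action of `Γ` on `B`. -/
def invariantEnd (B : Submodule ℤ V) (hB : ⊤ ≤ MulAction.stabilizer Γ B) :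
    Subalgebra ℤ (Module.End ℤ V) where
  carrier := {φ | (∀ C ≤ B, ⊤ ≤ MulAction.stabilizer Γ C → ∀ c ∈ C, φ c ∈ C) ∧
    ∀ (g : Γ), ∀ b ∈ B, φ (g • b) = g • φ b}
  mul_mem' {φ ψ} hφ hψ := ⟨fun C hC hCs c hc => hφ.1 C hC hCs _ (hψ.1 C hC hCs c hc),
    fun g b hb => by
      rw [Module.End.mul_apply, hψ.2 g b hb, hφ.2 g _ (hψ.1 B le_rfl hB b hb)]
      rfl⟩
  add_mem' {φ ψ} hφ hψ := ⟨fun C hC hCs c hc => C.add_mem (hφ.1 C hC hCs c hc) (hψ.1 C hC hCs c hc),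
    fun g b hb => by
      rw [LinearMap.add_apply, hφ.2 g b hb, hψ.2 g b hb, LinearMap.add_apply, smul_add]⟩
  algebraMap_mem' n := ⟨fun C _ _ c hc => C.smul_mem n hc, fun g b _ => by
    rw [Module.algebraMap_end_apply, Module.algebraMap_end_apply, smul_comm]⟩

theorem le_stabilizer_map {B : Submodule ℤ V} {hB : ⊤ ≤ MulAction.stabilizer Γ B}
    {φ : Module.End ℤ V} (hφ : φ ∈ invariantEnd Γ B hB) {C : Submodule ℤ V} (hC : C ≤ B)
    (hCs : ⊤ ≤ MulAction.stabilizer Γ C) : ⊤ ≤ MulAction.stabilizer Γ (C.map φ) := by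
  refine le_stabilizer_of_forall ?_
  rintro g hg _ ⟨c, hc, rfl⟩
  exact ⟨g • c, smul_mem_of_le_stabilizer hCs hg hc, hφ.2 g c (hC hc)⟩

theorem le_stabilizer_ker_inf {B : Submodule ℤ V} {hB : ⊤ ≤ MulAction.stabilizer Γ B}
    {φ : Module.End ℤ V} (hφ : φ ∈ invariantEnd Γ B hB) {C : Submodule ℤ V} (hC : C ≤ B)
    (hCs : ⊤ ≤ MulAction.stabilizer Γ C) :
    ⊤ ≤ MulAction.stabilizer Γ (LinearMap.ker φ ⊓ C) := by
  refine le_stabilizer_of_forall fun g hg c hc => ⟨?_, smul_mem_of_le_stabilizer hCs hg hc.2⟩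
  change φ (g • c) = 0
  rw [hφ.2 g c (hC hc.2), show φ c = 0 from hc.1, smul_zero]

theorem exists_pow_apply_eq_zero (hΓ : CyclicCentralChain (⊤ : Subgroup Γ)) {M : Submodule ℤ V}
    (hM0 : M ≠ ⊥) (hmin : ∀ A : Submodule ℤ V, ⊤ ≤ MulAction.stabilizer Γ A → A ≠ ⊥ → M ≤ A)
    {B : Submodule ℤ V} {hB : ⊤ ≤ MulAction.stabilizer Γ B} {y : Module.End ℤ V}
    (hy : y ∈ invariantEnd Γ B hB) (hyM : ∀ m ∈ M, y m = 0) {b : V} (hb : b ∈ B) :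
    ∃ n : ℕ, (y ^ n) b = 0 := by
  set C := orbitSpan ℤ (⊤ : Subgroup Γ) {b} with hCdef
  have hCs : ⊤ ≤ MulAction.stabilizer Γ C := fun h hh => smul_orbitSpan ⊤ {b} h hh
  have hCB : C ≤ B := orbitSpan_le hB (Set.singleton_subset_iff.2 hb)
  have hbC : b ∈ C := subset_orbitSpan _ _ rfl
  obtain ⟨n, hn⟩ := hΓ.orbitNoetherian (D := ℤ) (M := V) {b} (Set.finite_singleton b)
    (fun n => LinearMap.ker (y ^ n) ⊓ C)
    (monotone_nat_of_le_succ fun n x hx => ⟨by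
      change (y ^ (n + 1)) x = 0
      rw [pow_succ', Module.End.mul_apply, show (y ^ n) x = 0 from hx.1, map_zero], hx.2⟩)
    (fun n => le_stabilizer_ker_inf (pow_mem hy n) hCB hCs) (fun n => inf_le_right)
  refine ⟨n, ?_⟩
  by_contra hne
  have hMle : M ≤ C.map (y ^ n) := by
    refine hmin _ (le_stabilizer_map (pow_mem hy n) hCB hCs) fun h => hne ?_
    rw [← Submodule.mem_bot ℤ, ← h]
    exact Submodule.mem_map_of_mem hbC
  refine hM0 ((Submodule.eq_bot_iff _).2 fun m hm => ?_)
  obtain ⟨c, hc, rfl⟩ := hMle hm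
  have hc' : c ∈ LinearMap.ker (y ^ (n + 1)) ⊓ C := ⟨by
    change (y ^ (n + 1)) c = 0
    rw [pow_succ', Module.End.mul_apply, hyM _ hm], hc⟩
  have heq := hn (n + 1) (Nat.le_succ n)
  rw [show LinearMap.ker (y ^ (n + 1)) ⊓ C = LinearMap.ker (y ^ n) ⊓ C from heq] at hc'
  exact hc'.1

theorem exists_aeval_mul_self_eq_of_minimal (hΓ : CyclicCentralChain (⊤ : Subgroup Γ))
    {M : Submodule ℤ V} (hMs : ⊤ ≤ MulAction.stabilizer Γ M)
    (hmin : ∀ A : Submodule ℤ V, ⊤ ≤ MulAction.stabilizer Γ A → A ≠ ⊥ → M ≤ A)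
    {x : Module.End ℤ V} (hx : x ∈ invariantEnd Γ M hMs) (hxM : ∃ m ∈ M, x m ≠ 0) :
    ∃ u : Polynomial ℤ, ∀ m ∈ M, Polynomial.aeval x u (x m) = m := by
  let _ : DistribMulAction Γ M :=
    { smul := fun g m => ⟨g • (m : V), smul_mem_of_le_stabilizer hMs (Subgroup.mem_top g) m.2⟩
      one_smul := fun m => Subtype.ext (one_smul Γ (m : V))
      mul_smul := fun g h m => Subtype.ext (mul_smul g h (m : V))
      smul_zero := fun g => Subtype.ext (smul_zero g)
      smul_add := fun g m n => Subtype.ext (smul_add g (m : V) n) }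
  have hcoe : ∀ (g : Γ) (m : M), ((g • m : M) : V) = g • (m : V) := fun _ _ => rfl
  let xM : Module.End ℤ M := x.restrict (hx.1 M le_rfl hMs)
  obtain ⟨u, hu⟩ := exists_aeval_mul_self_eq_of_simple hΓ
    (fun A hA => by
      by_cases hA0 : A = ⊥
      · exact Or.inl hA0
      · right
        have hle := hmin (A.toIntSubmodule.map M.subtype) (le_stabilizer_of_forall (by
            rintro g _ _ ⟨a, ha, rfl⟩
            exact ⟨g • a, hA g a ha, rfl⟩)) (fun h => hA0 ((AddSubgroup.eq_bot_iff_forall _).2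
            fun a ha => by
              have : (a : V) ∈ A.toIntSubmodule.map M.subtype := ⟨a, ha, rfl⟩
              rw [h, Submodule.mem_bot] at this
              exact Subtype.ext this))
        refine eq_top_iff.2 fun m _ => ?_
        obtain ⟨a, ha, ham⟩ := hle m.2
        rwa [← Subtype.ext ham])
    xM (fun g m => Subtype.ext (hx.2 g m m.2))
    (fun h => by
      obtain ⟨m, hm, hxm⟩ := hxM
      exact hxm (congrArg Subtype.val (LinearMap.congr_fun h ⟨m, hm⟩)))
  refine ⟨u, fun m hm => ?_⟩
  have := map_aeval_apply xM x M.subtype.toAddMonoidHom (fun _ => rfl) u (xM ⟨m, hm⟩)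
  rw [hu, show Int.castRingHom ℤ = RingHom.id ℤ from Subsingleton.elim _ _,
    Polynomial.map_id] at this
  exact this.symm

theorem le_commutatorSpan_of_le_ker_pow {B : Submodule ℤ V} {hB : ⊤ ≤ MulAction.stabilizer Γ B}
    {x : Module.End ℤ V} (hx : x ∈ invariantEnd Γ B hB)
    (hker : ∀ C ≤ B, ⊤ ≤ MulAction.stabilizer Γ C → C ≤ LinearMap.ker x → C ≤ commutatorSpan Γ C)
    (n : ℕ) : ∀ C ≤ B, ⊤ ≤ MulAction.stabilizer Γ C → C ≤ LinearMap.ker (x ^ n) →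
      C ≤ commutatorSpan Γ C := by
  induction n with
  | zero =>
    intro C _ _ hC c hc
    rw [show c = 0 from hC hc]
    exact zero_mem _
  | succ n ih =>
    intro C hCB hCs hC c hc
    have hxC : C.map x ≤ C := by
      rintro _ ⟨c, hc, rfl⟩
      exact hx.1 C hCB hCs c hc
    have hmap : C.map x ≤ commutatorSpan Γ (C.map x) := by
      refine ih _ (hxC.trans hCB) (le_stabilizer_map hx hCB hCs) ?_
      rintro _ ⟨c, hc, rfl⟩
      exact hC hc
    have hspan : commutatorSpan Γ (C.map x) ≤ (commutatorSpan Γ C).map x := by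
      refine Submodule.span_le.2 ?_
      rintro _ ⟨g, _, ⟨c, hc, rfl⟩, rfl⟩
      exact ⟨g • c - c, sub_mem_commutatorSpan g hc, by rw [map_sub, hx.2 g c (hCB hc)]⟩
    obtain ⟨c', hc', hcc'⟩ := hspan (hmap ⟨c, hc, rfl⟩)
    have hc'C : c' ∈ C := by
      refine (Submodule.span_le.2 ?_ : commutatorSpan Γ C ≤ C) hc'
      rintro _ ⟨g, b, hb, rfl⟩
      exact C.sub_mem (smul_mem_of_le_stabilizer hCs (Subgroup.mem_top g) hb) hb
    have hd : c - c' ∈ LinearMap.ker x ⊓ C :=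
      ⟨LinearMap.mem_ker.2 (by rw [map_sub, hcc', sub_self]), C.sub_mem hc hc'C⟩
    have := commutatorSpan_mono inf_le_right (hker _ (inf_le_right.trans hCB)
      (le_stabilizer_ker_inf hx hCB hCs) inf_le_left hd)
    simpa using add_mem this hc'

theorem le_commutatorSpan_of_minimal (hΓ : CyclicCentralChain (⊤ : Subgroup Γ))
    {M : Submodule ℤ V} (hM0 : M ≠ ⊥) (hMs : ⊤ ≤ MulAction.stabilizer Γ M)
    (hmin : ∀ A : Submodule ℤ V, ⊤ ≤ MulAction.stabilizer Γ A → A ≠ ⊥ → M ≤ A)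
    (hnc : ∃ g : Γ, ∃ m ∈ M, g • m ≠ m) (B : Submodule ℤ V)
    (hB : ⊤ ≤ MulAction.stabilizer Γ B) : B ≤ commutatorSpan Γ B := by
  have key : ∀ H : Subgroup Γ, CyclicCentralChain H →
      (∀ B : Submodule ℤ V, ⊤ ≤ MulAction.stabilizer Γ B → (∀ h ∈ H, ∀ b ∈ B, h • b = b) →
        B ≤ commutatorSpan Γ B) →
      ∀ B : Submodule ℤ V, ⊤ ≤ MulAction.stabilizer Γ B → B ≤ commutatorSpan Γ B := by
    intro H hH
    induction hH with
    | bot =>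
      refine fun h B hB => h B hB fun g hg b _ => ?_
      rw [Subgroup.mem_bot.1 hg, one_smul]
    | sup_zpowers H t _ ht ih =>
      refine fun hS => ih fun B hB htriv => ?_
      by_cases hB0 : B = ⊥
      · rw [hB0]
        exact bot_le
      have hMB : M ≤ B := hmin B hB hB0
      let x : Module.End ℤ V := DistribSMul.toLinearMap ℤ V t - 1
      have hxapply : ∀ v, x v = t • v - v := fun v => rfl
      have hx : x ∈ invariantEnd Γ B hB := by
        refine ⟨fun C _ hCs c hc => C.sub_mem
          (smul_mem_of_le_stabilizer hCs (Subgroup.mem_top t) hc) hc, fun g b hb => ?_⟩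
        have h1 := htriv _ (ht g) _
          (smul_mem_of_le_stabilizer hB (Subgroup.mem_top (g * t)) hb)
        rw [← mul_smul, commutatorElement_def,
          show t * g * t⁻¹ * g⁻¹ * (g * t) = t * g by group] at h1
        rw [hxapply, hxapply, smul_sub, ← mul_smul, ← mul_smul, h1]
      by_cases hxM : ∃ m ∈ M, x m ≠ 0
      · have hxinv : x ∈ invariantEnd Γ M hMs :=
          ⟨fun C hC => hx.1 C (hC.trans hMB), fun g b hb => hx.2 g b (hMB hb)⟩
        obtain ⟨u, hu⟩ := exists_aeval_mul_self_eq_of_minimal hΓ hMs hmin hxinv hxM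
        have hux : Polynomial.aeval x u ∈ invariantEnd Γ B hB :=
          Algebra.adjoin_le (Set.singleton_subset_iff.2 hx)
            (Polynomial.aeval_mem_adjoin_singleton ℤ x)
        have hcomm : Polynomial.aeval x u * x = x * Polynomial.aeval x u :=
          (Algebra.commute_of_mem_adjoin_self
            (Polynomial.aeval_mem_adjoin_singleton ℤ x)).symm.eq
        let y : Module.End ℤ V := 1 - Polynomial.aeval x u * x
        have hy : y ∈ invariantEnd Γ B hB := sub_mem (one_mem _) (mul_mem hux hx)
        intro b hb
        obtain ⟨n, hn⟩ := exists_pow_apply_eq_zero hΓ hM0 hmin hy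
          (fun m hm => by simp [y, hu m hm]) hb
        let s : Module.End ℤ V := ∑ i ∈ Finset.range n, y ^ i
        have hs : s ∈ invariantEnd Γ B hB := sum_mem fun i _ => pow_mem hy i
        have hsum : x * (Polynomial.aeval x u * s) = 1 - y ^ n := by
          rw [← mul_neg_geom_sum y n, ← mul_assoc, ← hcomm]
          simp [y, s]
        have hbx : x ((Polynomial.aeval x u * s) b) = b := by
          have := LinearMap.congr_fun hsum b
          simpa [hn] using this
        rw [← hbx, hxapply]
        exact sub_mem_commutatorSpan t ((mul_mem hux hs).1 B le_rfl hB b hb)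
      · push Not at hxM
        intro b hb
        obtain ⟨n, hn⟩ := exists_pow_apply_eq_zero hΓ hM0 hmin hx hxM hb
        have hkinv := le_stabilizer_ker_inf (pow_mem hx n) le_rfl hB
        refine commutatorSpan_mono inf_le_right (le_commutatorSpan_of_le_ker_pow hx
          (fun C hCB hCs hCk => hS C hCs fun h hh c hc => ?_) n (LinearMap.ker (x ^ n) ⊓ B)
          inf_le_right hkinv inf_le_left ⟨hn, hb⟩)
        have hle : H ⊔ Subgroup.zpowers t ≤ MulAction.stabilizer Γ c := by
          refine sup_le (fun h hh => htriv h hh c (hCB hc)) (Subgroup.zpowers_le.2 ?_)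
          exact sub_eq_zero.1 (hCk hc)
        exact hle hh
  refine key ⊤ hΓ (fun B hB htriv => ?_) B hB
  by_cases hB0 : B = ⊥
  · rw [hB0]
    exact bot_le
  · obtain ⟨g, m, hm, hgm⟩ := hnc
    exact absurd (htriv g (Subgroup.mem_top g) m (hmin B hB hB0 hm)) hgm
end

/-- Let `A` be an abelian normal subgroup of `G` with `G/A` finitely generated nilpotent.
If `A` is `G`-monolithic with `G`-monolith `M` and `M` is not `G`-central, then `[A,G] = A`. -/
theorem commutator_eq_self_of_monolithic {G : Type*} [Group G] (A : Subgroup G)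
    [A.Normal] (hab : ∀ x ∈ A, ∀ y ∈ A, x * y = y * x)
    (hfg : Group.FG (G ⧸ A)) (hnil : Group.IsNilpotent (G ⧸ A))
    (M : Subgroup G)
    (hM : M = sInf {B : Subgroup G | B.Normal ∧ B ≤ A ∧ B ≠ ⊥})
    (hmono : M ≠ ⊥)
    (hecc : ⁅(⊤ : Subgroup G), M⁆ ≠ ⊥) :
    ⁅A, (⊤ : Subgroup G)⁆ = A := by
  have hmin : ∀ B : Subgroup G, B.Normal → B ≤ A → B ≠ ⊥ → M ≤ B := fun B h1 h2 h3 => by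
    rw [hM]
    exact sInf_le ⟨h1, h2, h3⟩
  have hMn : M.Normal := by
    refine ⟨fun m hm g => ?_⟩
    rw [hM, Subgroup.mem_sInf] at hm ⊢
    exact fun B hB => hB.1.conj_mem m (hm B hB) g
  refine le_antisymm (Subgroup.commutator_le_left A ⊤) ?_
  by_cases hA0 : A = ⊥
  · rw [hA0]
    exact bot_le
  have hMA : M ≤ A := hmin A inferInstance le_rfl hA0
  let _ : CommGroup A :=
    { (inferInstance : Group A) with mul_comm := fun a b => Subtype.ext (hab a a.2 b b.2) }
  let ρ : G ⧸ A →* MulAut A := QuotientGroup.lift A MulAut.conjNormal fun a ha => by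
    ext b
    simp [hab a ha b b.2]
  have hρ : ∀ (g : G) (a : A), ((ρ (g : G ⧸ A) a : A) : G) = g * a * g⁻¹ := fun g a =>
    MulAut.conjNormal_apply g a
  let _ : DistribMulAction (G ⧸ A) (Additive A) :=
    { smul := fun q v => Additive.ofMul (ρ q v.toMul)
      one_smul := fun v => by
        change Additive.ofMul (ρ 1 v.toMul) = v
        simp
      mul_smul := fun q r v => by
        change Additive.ofMul (ρ (q * r) v.toMul) = Additive.ofMul (ρ q (ρ r v.toMul))
        simp
      smul_zero := fun q => congrArg Additive.ofMul (map_one (ρ q))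
      smul_add := fun q v w => congrArg Additive.ofMul (map_mul (ρ q) v.toMul w.toMul) }
  have hsmul : ∀ (g : G) (v : Additive A),
      ((((g : G ⧸ A) • v : Additive A).toMul : A) : G) = g * (v.toMul : A) * g⁻¹ :=
    fun g v => hρ g v.toMul
  let toSub : Subgroup G → Submodule ℤ (Additive A) := fun K =>
    AddSubgroup.toIntSubmodule (Subgroup.toAddSubgroup (K.subgroupOf A))
  have hmem : ∀ (K : Subgroup G) (v : Additive A), v ∈ toSub K ↔ ((v.toMul : A) : G) ∈ K :=
    fun K v => Iff.rfl
  have hspan := le_commutatorSpan_of_minimal (Γ := G ⧸ A) (V := Additive A)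
    CyclicCentralChain.top_of_fg_of_isNilpotent (M := toSub M) ?_ ?_ ?_ ?_ ⊤ ?_
  · intro a ha
    have hle : commutatorSpan (G ⧸ A) (⊤ : Submodule ℤ (Additive A)) ≤
        toSub ⁅A, (⊤ : Subgroup G)⁆ := by
      refine Submodule.span_le.2 ?_
      rintro _ ⟨q, b, _, rfl⟩
      obtain ⟨g, rfl⟩ := QuotientGroup.mk_surjective q
      rw [SetLike.mem_coe, hmem, toMul_sub, Subgroup.coe_div, hsmul, div_eq_mul_inv]
      rw [Subgroup.commutator_comm]
      exact Subgroup.commutator_mem_commutator (Subgroup.mem_top g) b.toMul.2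
    exact hle (hspan (Submodule.mem_top (x := Additive.ofMul (⟨a, ha⟩ : A))))
  · intro h
    refine hmono ((Subgroup.eq_bot_iff_forall _).2 fun m hm => ?_)
    have : Additive.ofMul (⟨m, hMA hm⟩ : A) ∈ toSub M := hm
    rw [h, Submodule.mem_bot] at this
    exact congrArg (fun v : Additive A => (v.toMul : G)) this
  · refine le_stabilizer_of_forall fun q _ v hv => ?_
    obtain ⟨g, rfl⟩ := QuotientGroup.mk_surjective q
    rw [hmem, hsmul]
    exact hMn.conj_mem _ hv g
  · intro N hN hN0 v hv
    let K : Subgroup G := (AddSubgroup.toSubgroup' N.toAddSubgroup).map A.subtype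
    have hK : ∀ v : Additive A, ((v.toMul : A) : G) ∈ K ↔ v ∈ N := fun v => by
      refine ⟨?_, fun h => ⟨v.toMul, h, rfl⟩⟩
      rintro ⟨w, hw, hwv⟩
      rwa [← show Additive.ofMul w = v from Subtype.ext hwv]
    refine (hK v).1 (hmin K ⟨?_⟩ ?_ ?_ hv)
    · rintro _ ⟨w, hw, rfl⟩ g
      have := (hK ((g : G ⧸ A) • Additive.ofMul w)).2
        (smul_mem_of_le_stabilizer hN (Subgroup.mem_top _) hw)
      rwa [hsmul] at this
    · rintro _ ⟨w, _, rfl⟩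
      exact w.2
    · intro h
      refine hN0 ((Submodule.eq_bot_iff _).2 fun w hw => ?_)
      have := (hK w).2 hw
      rw [h, Subgroup.mem_bot] at this
      exact Subtype.ext this
  · by_contra! h
    refine hecc (Subgroup.commutator_eq_bot_iff_le_centralizer.2 fun g _ m hm => ?_)
    have := congrArg (fun v : Additive A => (v.toMul : G))
      (h (g : G ⧸ A) (Additive.ofMul ⟨m, hMA hm⟩) hm)
    simp only [hsmul] at this
    exact (mul_inv_eq_iff_eq_mul.1 this).symm
  · exact le_stabilizer_of_forall fun _ _ _ _ => trivial
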